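/- arXiv:1605.08989 — 7 statements merged into one kernel-verified Lean document; each statement's English description precedes it below -/
import Mathlib

section
/- Let (X, r_X, μ_X) and (Y, r_Y, μ_Y) be probability mm spaces with (X, r_X, μ_X) ≼_metric (Y, r_Y, μ_Y). Then for every m ≥ 2 and every bounded continuous increasing function φ : ℝ^{m(m−1)/2} → ℝ one has ∫ φ dν^{m,(X,r_X,μ_X)} ≤ ∫ φ dν^{m,(Y,r_Y,μ_Y)}. -/
open MeasureTheory Metric Filter Topology

namespace MMOrder

/-- The support of a Borel measure on a metric space: the set of points all of whose
open balls have positive mass. -/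
def msupp {X : Type*} [MeasurableSpace X] [MetricSpace X] (μ : Measure X) : Set X :=
  {x : X | ∀ ε : ℝ, 0 < ε → 0 < μ (Metric.ball x ε)}

/-- `τ` is a measure-preserving sub-isometry from `(Y, r_Y, μY)` to `(X, r_X, μX)`:
it maps `supp μY` into `supp μX`, pushes `μY` forward to `μX`, and is `1`-Lipschitz
on the support of `μY`. -/
def IsMPSubIsom {X Y : Type*} [MeasurableSpace X] [MetricSpace X]
    [MeasurableSpace Y] [MetricSpace Y] (μX : Measure X) (μY : Measure Y) (τ : Y → X) : Prop :=
  Measurable τ ∧ Set.MapsTo τ (msupp μY) (msupp μX) ∧ μY.map τ = μX ∧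
    ∀ y₁ ∈ msupp μY, ∀ y₂ ∈ msupp μY, dist (τ y₁) (τ y₂) ≤ dist y₁ y₂

/-- `(X, r_X, μX) ≼_metric (Y, r_Y, μY)`: there is a measure-preserving sub-isometry
from `(Y, r_Y, μY)` to `(X, r_X, μX)`. -/
def LeMetric {X Y : Type*} [MeasurableSpace X] [MetricSpace X]
    [MeasurableSpace Y] [MetricSpace Y] (μX : Measure X) (μY : Measure Y) : Prop :=
  ∃ τ : Y → X, IsMPSubIsom μX μY τ

/-- `(X, r_X, μX) ≼ (Y, r_Y, μY)`: there is a Borel measure `μY' ≤ μY` on `Y` and a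
measure-preserving sub-isometry from `(Y, r_Y, μY')` to `(X, r_X, μX)`. -/
def LeGen {X Y : Type*} [MeasurableSpace X] [MetricSpace X]
    [MeasurableSpace Y] [MetricSpace Y] (μX : Measure X) (μY : Measure Y) : Prop :=
  ∃ μY' : Measure Y, μY' ≤ μY ∧ LeMetric μX μY'

/-- `(X, r_X, μX) ≼_measure (Y, r_Y, μY)`: there is an isometry `τ` on `supp μY`
with `μX ≤ μY ∘ τ⁻¹`. -/
def LeMeasure {X Y : Type*} [MeasurableSpace X] [MetricSpace X]
    [MeasurableSpace Y] [MetricSpace Y] (μX : Measure X) (μY : Measure Y) : Prop :=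
  ∃ τ : Y → X, Measurable τ ∧
    (∀ y₁ ∈ msupp μY, ∀ y₂ ∈ msupp μY, dist (τ y₁) (τ y₂) = dist y₁ y₂) ∧
    μX ≤ μY.map τ

/-- Two mm spaces are equivalent: there is a measurable map `φ : X → Y` pushing `μX`
forward to `μY` which restricts to an isometry on `supp μX` (onto its image). -/
def MMEquiv {X Y : Type*} [MeasurableSpace X] [MetricSpace X]
    [MeasurableSpace Y] [MetricSpace Y] (μX : Measure X) (μY : Measure Y) : Prop :=
  ∃ φ : X → Y, Measurable φ ∧ μX.map φ = μY ∧
    ∀ x₁ ∈ msupp μX, ∀ x₂ ∈ msupp μX, dist (φ x₁) (φ x₂) = dist x₁ x₂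

/-- Index set for the entries of a distance matrix of order `m`:
pairs `(i, j)` with `i < j`; it has `m(m-1)/2` elements, so `DIdx m → ℝ` is
`ℝ^{m(m-1)/2}` with its coordinatewise partial order. -/
def DIdx (m : ℕ) : Type := {p : Fin m × Fin m // p.1 < p.2}

instance (m : ℕ) : MeasurableSpace (DIdx m → ℝ) := by unfold DIdx; infer_instance
instance (m : ℕ) : PartialOrder (DIdx m → ℝ) := by unfold DIdx; infer_instance

/-- The distance matrix map of order `m`. -/
def distMatMap {X : Type*} [MetricSpace X] (m : ℕ) (x : Fin m → X) : DIdx m → ℝ :=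
  fun p => dist (x p.val.1) (x p.val.2)

/-- The distance matrix measure of order `m`: the pushforward of `μ^{⊗ m}` under the
distance matrix map. -/
noncomputable def nuM {X : Type*} [MeasurableSpace X] [MetricSpace X]
    (μ : Measure X) (m : ℕ) : Measure (DIdx m → ℝ) :=
  (Measure.pi fun _ : Fin m => μ).map (distMatMap m)

/-- The distance matrix measure of order `2`, viewed as a measure on `ℝ`
(the law of the distance of two independently sampled points). -/
noncomputable def nu2 {X : Type*} [MeasurableSpace X] [MetricSpace X]
    (μ : Measure X) : Measure ℝ :=
  (μ.prod μ).map fun p : X × X => dist p.1 p.2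

/-- `∫ (1 - e^{-λ r}) ν^{2,(X,r,μ)}(dr)`. -/
noncomputable def nu2Int {X : Type*} [MeasurableSpace X] [MetricSpace X]
    (l : ℝ) (μ : Measure X) : ℝ :=
  ∫ r, (1 - Real.exp (-l * r)) ∂(nu2 μ)

/-- A metric measure space: a complete separable metric space together with a finite
Borel measure. -/
structure MM : Type 1 where
  carrier : Type
  ms : MeasurableSpace carrier
  met : MetricSpace carrier
  sep : SecondCountableTopology carrier
  cmp : CompleteSpace carrier
  bor : BorelSpace carrier
  μ : Measure carrier
  fin : IsFiniteMeasure μ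

attribute [instance] MM.ms MM.met MM.sep MM.cmp MM.bor MM.fin

/-- Gromov-weak convergence of a sequence of mm spaces: convergence of total masses and
of all integrals of bounded continuous test functions against the distance matrix
measures of every order `m ≥ 2`. -/
def GromovWeakTendsto (Z : ℕ → MM) (W : MM) : Prop :=
  Tendsto (fun n => (Z n).μ Set.univ) atTop (nhds (W.μ Set.univ)) ∧
  ∀ m : ℕ, 2 ≤ m → ∀ φ : (DIdx m → ℝ) → ℝ, Continuous φ → (∃ C : ℝ, ∀ v, |φ v| ≤ C) →
    Tendsto (fun n => ∫ v, φ v ∂(nuM (Z n).μ m)) atTop (nhds (∫ v, φ v ∂(nuM W.μ m)))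

/-- `Q` is a coupling of `μX` and `μY`. -/
def IsCoupling {X Y : Type*} [MeasurableSpace X] [MeasurableSpace Y]
    (μX : Measure X) (μY : Measure Y) (Q : Measure (X × Y)) : Prop :=
  Q.map Prod.fst = μX ∧ Q.map Prod.snd = μY

/-- The Eurandom cost `∬ |e^{-λ r_Y(y,y')} - e^{-λ r_X(x,x')}| Q(d(x,y)) Q(d(x',y'))`
of a coupling `Q`. -/
noncomputable def eurCost {X Y : Type*} [MeasurableSpace X] [MetricSpace X]
    [MeasurableSpace Y] [MetricSpace Y] (l : ℝ) (Q : Measure (X × Y)) : ℝ :=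
  ∫ p, |Real.exp (-l * dist p.1.2 p.2.2) - Real.exp (-l * dist p.1.1 p.2.1)| ∂(Q.prod Q)

/-- The Eurandom distance `dEur^λ`: the infimum of the Eurandom cost over all couplings. -/
noncomputable def dEur {X Y : Type*} [MeasurableSpace X] [MetricSpace X]
    [MeasurableSpace Y] [MetricSpace Y] (l : ℝ) (μX : Measure X) (μY : Measure Y) : ℝ :=
  sInf {c : ℝ | ∃ Q : Measure (X × Y), IsCoupling μX μY Q ∧ c = eurCost l Q}

/-- The generalized Eurandom distance `dgEur^λ`. -/
noncomputable def dgEur {X Y : Type*} [MeasurableSpace X] [MetricSpace X]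
    [MeasurableSpace Y] [MetricSpace Y] (l : ℝ) (μX : Measure X) (μY : Measure Y) : ℝ :=
  sInf {c : ℝ | ∃ (μX' : Measure X) (μY' : Measure Y), μX' ≤ μX ∧ μY' ≤ μY ∧
    μX' Set.univ = μY' Set.univ ∧
    c = ((nu2Int l μX - nu2Int l μX') + (nu2Int l μY - nu2Int l μY')) + dEur l μX' μY'}

/-- The metric `c · r` obtained by scaling a metric by a positive constant. -/
noncomputable def scaleMetric {X : Type*} (c : ℝ) (hc : 0 < c) (m : MetricSpace X) :
    MetricSpace X where
  dist x y := c * m.dist x y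
  dist_self x := by simp [m.dist_self]
  dist_comm x y := by simp [m.dist_comm x y]
  dist_triangle x y z := by
    show c * m.dist x z ≤ c * m.dist x y + c * m.dist y z
    have h := mul_le_mul_of_nonneg_left (m.dist_triangle x y z) hc.le
    linarith
  eq_of_dist_eq_zero := by
    intro x y h
    have h' : c * m.dist x y = 0 := h
    exact m.eq_of_dist_eq_zero (by
      rcases mul_eq_zero.1 h' with h'' | h''
      · exact absurd h'' hc.ne'
      · exact h'')

/-- The `ℓ¹`-sum metric `r_X ⊕ r_Z` on a product space. -/
noncomputable def sumMetric {X Z : Type*} (mX : MetricSpace X) (mZ : MetricSpace Z) :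
    MetricSpace (X × Z) where
  dist p q := mX.dist p.1 q.1 + mZ.dist p.2 q.2
  dist_self p := by simp [mX.dist_self, mZ.dist_self]
  dist_comm p q := by simp [mX.dist_comm p.1 q.1, mZ.dist_comm p.2 q.2]
  dist_triangle p q s := by
    show mX.dist p.1 s.1 + mZ.dist p.2 s.2 ≤
      (mX.dist p.1 q.1 + mZ.dist p.2 q.2) + (mX.dist q.1 s.1 + mZ.dist q.2 s.2)
    have h1 := mX.dist_triangle p.1 q.1 s.1
    have h2 := mZ.dist_triangle p.2 q.2 s.2
    linarith
  eq_of_dist_eq_zero := by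
    intro p q h
    have h' : mX.dist p.1 q.1 + mZ.dist p.2 q.2 = 0 := h
    have n1 := @dist_nonneg _ mX.toPseudoMetricSpace p.1 q.1
    have n2 := @dist_nonneg _ mZ.toPseudoMetricSpace p.2 q.2
    exact Prod.ext (mX.eq_of_dist_eq_zero (by linarith)) (mZ.eq_of_dist_eq_zero (by linarith))

/-- The modulus of mass distribution `v_δ`. -/
noncomputable def vDelta {X : Type*} [MeasurableSpace X] [MetricSpace X]
    (μ : Measure X) (δ : ℝ) : ℝ :=
  sInf {ε : ℝ | 0 < ε ∧ μ {x : X | μ (Metric.ball x ε) ≤ ENNReal.ofReal δ} < ENNReal.ofReal ε}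

/-- `P` is the countable product `μ^{⊗ ℕ}` of the probability measure `μ`, characterized
by its values on measurable cylinder sets. -/
def IsInfiniteProduct {X : Type*} [MeasurableSpace X] (μ : Measure X)
    (P : Measure (ℕ → X)) : Prop :=
  IsProbabilityMeasure P ∧ ∀ (s : Finset ℕ) (A : ℕ → Set X), (∀ i, MeasurableSet (A i)) →
    P {f : ℕ → X | ∀ i ∈ s, f i ∈ A i} = ∏ i ∈ s, μ (A i)

/-- Index set for the entries of the infinite distance matrix: pairs `(i, j)` of
naturals with `i < j`. -/
def NIdx : Type := {p : ℕ × ℕ // p.1 < p.2}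

instance : MeasurableSpace (NIdx → ℝ) := by unfold NIdx; infer_instance
instance : PartialOrder (NIdx → ℝ) := by unfold NIdx; infer_instance

/-- The infinite distance matrix map. -/
def distMatMapInf {X : Type*} [MetricSpace X] (x : ℕ → X) : NIdx → ℝ :=
  fun p => dist (x p.val.1) (x p.val.2)

/-- The simple graph on `Fin n` determined by a family of edge indicators indexed by
the pairs `i < j`. -/
def graphOf {n : ℕ} (b : DIdx n → Bool) : SimpleGraph (Fin n) :=
  SimpleGraph.fromRel fun i j => ∃ e : DIdx n, (e.val = (i, j) ∨ e.val = (j, i)) ∧ b e = true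

/-- Graph distance with the convention that points in different connected components
are at distance `n`. -/
noncomputable def graphDist {n : ℕ} (g : SimpleGraph (Fin n)) (i j : Fin n) : ℝ :=
  @ite ℝ (g.Reachable i j) (Classical.dec _) (g.dist i j : ℝ) (n : ℝ)

theorem measSpace_eq (m : ℕ) :
    instMeasurableSpaceForallDIdxReal m = (MeasurableSpace.pi : MeasurableSpace (DIdx m → ℝ)) := rfl

theorem le_iff_DIdx {m : ℕ} (v w : DIdx m → ℝ) : v ≤ w ↔ ∀ p, v p ≤ w p := Iff.rfl

instance finite_DIdx (m : ℕ) : Finite (DIdx m) := by unfold DIdx; infer_instance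

theorem msupp_eq {X : Type*} [MeasurableSpace X] [MetricSpace X] (μ : Measure X) :
    msupp μ = μ.support := by
  ext x
  rw [Measure.mem_support_iff_forall]
  constructor
  · intro h U hU
    obtain ⟨ε, hε, hs⟩ := Metric.mem_nhds_iff.1 hU
    exact (h ε hε).trans_le (measure_mono hs)
  · intro h ε hε
    exact h _ (Metric.ball_mem_nhds x hε)

theorem measurable_distMatMap {X : Type*} [MeasurableSpace X] [MetricSpace X]
    [SecondCountableTopology X] [BorelSpace X] (m : ℕ) :
    Measurable (distMatMap m : (Fin m → X) → DIdx m → ℝ) := by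
  rw [measSpace_eq]
  refine measurable_pi_lambda _ fun p => ?_
  exact (measurable_pi_apply _).dist (measurable_pi_apply _)

theorem measurable_of_cont {m : ℕ} {φ : (DIdx m → ℝ) → ℝ} (h : Continuous φ) :
    Measurable φ := by
  rw [measSpace_eq]
  have : @OpensMeasurableSpace (DIdx m → ℝ) _ MeasurableSpace.pi :=
    @Pi.opensMeasurableSpace (DIdx m) (fun _ => ℝ) _ _ _ _ _
  exact @Continuous.measurable (DIdx m → ℝ) ℝ _ MeasurableSpace.pi this _ _ _ φ h

/-- if `(X, r_X, μ_X) ≼_metric (Y, r_Y, μ_Y)` (probability mm spaces), then the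
integral of every bounded continuous increasing `φ` against the order-`m` distance matrix
measures is monotone, for every `m ≥ 2`. -/
theorem stmt0 {X Y : Type*} [MeasurableSpace X] [MetricSpace X] [SecondCountableTopology X] [CompleteSpace X] [BorelSpace X] [MeasurableSpace Y] [MetricSpace Y] [SecondCountableTopology Y] [CompleteSpace Y] [BorelSpace Y]
    (μX : Measure X) (μY : Measure Y)
    [IsProbabilityMeasure μX] [IsProbabilityMeasure μY]
    (h : LeMetric μX μY) (m : ℕ) (hm : 2 ≤ m)
    (φ : (DIdx m → ℝ) → ℝ) (hφc : Continuous φ) (hφb : ∃ C : ℝ, ∀ v, |φ v| ≤ C)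
    (hφmono : Monotone φ) :
    ∫ v, φ v ∂(nuM μX m) ≤ ∫ v, φ v ∂(nuM μY m) := by
  obtain ⟨τ, hτ, -, hmap, hlip⟩ := h
  obtain ⟨C, hC⟩ := hφb
  have hφm := measurable_of_cont hφc
  have hpi : (Measure.pi fun _ : Fin m => μX) =
      (Measure.pi fun _ : Fin m => μY).map (fun y i => τ (y i)) := by
    subst hmap
    exact (Measure.pi_map_pi (fun _ => hτ.aemeasurable)).symm
  have hτpi : Measurable (fun (y : Fin m → Y) (i : Fin m) => τ (y i)) :=
    measurable_pi_lambda _ fun i => hτ.comp (measurable_pi_apply i)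
  unfold nuM
  rw [integral_map (measurable_distMatMap m).aemeasurable hφm.aestronglyMeasurable,
    integral_map (measurable_distMatMap m).aemeasurable hφm.aestronglyMeasurable, hpi,
    integral_map (f := fun x => φ (distMatMap m x)) hτpi.aemeasurable
      (hφm.comp (measurable_distMatMap m)).aestronglyMeasurable]
  have hsupp : ∀ᵐ y ∂μY, y ∈ msupp μY := by
    rw [msupp_eq]; exact Measure.support_mem_ae
  have hall : ∀ᵐ y ∂(Measure.pi fun _ : Fin m => μY), ∀ i, y i ∈ msupp μY := by
    rw [ae_all_iff]
    intro i
    exact (Measure.quasiMeasurePreserving_eval (fun _ : Fin m => μY) i).ae hsupp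
  refine integral_mono_ae ?_ ?_ ?_
  · exact Integrable.of_bound
      ((hφm.comp (measurable_distMatMap m)).comp hτpi).aestronglyMeasurable C
      (Eventually.of_forall fun y => hC _)
  · exact Integrable.of_bound
      (hφm.comp (measurable_distMatMap m)).aestronglyMeasurable C
      (Eventually.of_forall fun y => hC _)
  · filter_upwards [hall] with y hy
    apply hφmono
    rw [le_iff_DIdx]
    intro p
    exact hlip _ (hy _) _ (hy _)

end MMOrder
end

section
/- Let (X, r_X, μ_X) and (Y, r_Y, μ_Y) be probability mm spaces, and let ν^{∞,(X,r_X,μ_X)} and ν^{∞,(Y,r_Y,μ_Y)} denote the infinite distance matrix measures, i.e. the pushforwards of the countable product measures μ_X^{⊗ℕ} and μ_Y^{⊗ℕ} under the map (x_i)_{i∈ℕ} ↦ (r(x_i,x_j))_{i<j} into the countable product space ℝ^{{(i,j): i<j, i,j∈ℕ}} with its product Borel σ-field. If ν^{∞,(X,r_X,μ_X)}(A) ≤ ν^{∞,(Y,r_Y,μ_Y)}(A) for every increasing Borel set A (increasing with respect to the pointwise partial order on the product space), then (X, r_X, μ_X) ≼_metric (Y, r_Y, μ_Y), i.e. there exists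 a measure-preserving sub-isometry from (Y, r_Y, μ_Y) to (X, r_X, μ_X). -/
open MeasureTheory Metric Filter Topology

namespace MMOrder

/-- Empirical frequency. -/
noncomputable def freq {X : Type*} (x : ℕ → X) (U : Set X) (n : ℕ) : ℝ :=
  (∑ i ∈ Finset.range n, U.indicator (fun _ => (1 : ℝ)) (x i)) / n

/-- Typical sequences. -/
def Good {X : Type*} [MeasurableSpace X] [MetricSpace X] (μ : Measure X) (x : ℕ → X) : Prop :=
  ∀ U : Set X, IsOpen U → ∀ c : ℝ, c < μ.real U → ∀ᶠ n in atTop, c < freq x U n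

lemma freq_mono {X : Type*} (x : ℕ → X) {U V : Set X} (h : U ⊆ V) (n : ℕ) :
    freq x U n ≤ freq x V n := by
  unfold freq
  refine div_le_div_of_nonneg_right (Finset.sum_le_sum fun i _ => ?_) (Nat.cast_nonneg n)
  exact Set.indicator_le_indicator_of_subset h (fun _ => zero_le_one) _

lemma ae_tendsto_freq {X : Type*} [MeasurableSpace X] (μ : Measure X) (P : Measure (ℕ → X))
    (hP : IsInfiniteProduct μ P) (U : Set X) (hU : MeasurableSet U) :
    ∀ᵐ x ∂P, Tendsto (freq x U) atTop (𝓝 (μ.real U)) := by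
  obtain ⟨hprob, hprod⟩ := hP
  have hone : ∀ (i : ℕ) (A : Set X), MeasurableSet A →
      P ((fun f : ℕ → X => f i) ⁻¹' A) = μ A := by
    intro i A hA
    have := hprod {i} (fun _ => A) (fun _ => hA)
    simp only [Finset.mem_singleton, forall_eq, Finset.prod_singleton] at this
    exact this
  have hmap : ∀ i : ℕ, P.map (fun f : ℕ → X => f i) = μ := by
    intro i
    ext A hA
    rw [Measure.map_apply (measurable_pi_apply i) hA, hone i A hA]
  have hind : ProbabilityTheory.iIndepFun (fun (i : ℕ) (f : ℕ → X) => f i) P := by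
    rw [ProbabilityTheory.iIndepFun_iff_measure_inter_preimage_eq_mul]
    intro S sets H
    classical
    have := hprod S (fun i => if i ∈ S then sets i else Set.univ) (by
      intro i
      by_cases hi : i ∈ S
      · simpa [hi] using H i hi
      · simp [hi])
    have e : (⋂ i ∈ S, (fun f : ℕ → X => f i) ⁻¹' sets i) =
        {f : ℕ → X | ∀ i ∈ S, f i ∈ (if i ∈ S then sets i else Set.univ)} := by
      ext f
      simp only [Set.mem_iInter, Set.mem_preimage, Set.mem_setOf_eq]
      refine forall₂_congr fun i hi => by simp [hi]
    rw [e, this]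
    refine Finset.prod_congr rfl fun i hi => ?_
    rw [hone i _ (H i hi)]
    simp [hi]
  set g : X → ℝ := U.indicator (fun _ => (1 : ℝ)) with hg
  have gm : Measurable g := measurable_const.indicator hU
  have key := ProbabilityTheory.strong_law_ae_real (μ := P) (fun i => g ∘ (fun f : ℕ → X => f i))
    ?_ ?_ ?_
  · have e : ∫ a, (g ∘ (fun f : ℕ → X => f 0)) a ∂P = μ.real U := by
      have := integral_map (μ := P) (φ := fun f : ℕ → X => f 0) (f := g)
        (measurable_pi_apply 0).aemeasurable gm.aestronglyMeasurable
      simp only [Function.comp]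
      rw [← this, hmap, hg, integral_indicator_const _ hU]
      simp
    rw [e] at key
    filter_upwards [key] with x hx
    exact hx
  · have : Integrable (fun f : ℕ → X => ((fun f : ℕ → X => f 0) ⁻¹' U).indicator
        (fun _ => (1 : ℝ)) f) P :=
      (integrable_const 1).indicator (measurable_pi_apply 0 hU)
    exact this
  · intro i j hij
    exact (hind.comp (fun _ => g) (fun _ => gm)).indepFun hij
  · intro i
    refine ProbabilityTheory.IdentDistrib.comp ⟨(measurable_pi_apply i).aemeasurable,
      (measurable_pi_apply 0).aemeasurable, ?_⟩ gm
    rw [hmap, hmap]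

lemma ae_good {X : Type*} [MeasurableSpace X] [MetricSpace X] [SecondCountableTopology X]
    [BorelSpace X] (μ : Measure X) [IsProbabilityMeasure μ] (P : Measure (ℕ → X))
    (hP : IsInfiniteProduct μ P) : ∀ᵐ x ∂P, Good μ x := by
  set B := TopologicalSpace.countableBasis X
  have hB : TopologicalSpace.IsTopologicalBasis B := TopologicalSpace.isBasis_countableBasis X
  have hBc : Countable B := (TopologicalSpace.countable_countableBasis X).to_subtype
  have h1 : ∀ᵐ x ∂P, ∀ t : Finset B,
      Tendsto (freq x (⋃ s ∈ t, (s : Set X))) atTop (𝓝 (μ.real (⋃ s ∈ t, (s : Set X)))) := by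
    rw [ae_all_iff]
    intro t
    refine ae_tendsto_freq μ P hP _ (IsOpen.measurableSet ?_)
    exact isOpen_biUnion fun s _ => hB.isOpen s.2
  filter_upwards [h1] with x hx U hU c hc
  obtain hc0 | hc0 := lt_or_ge c 0
  · refine Eventually.of_forall fun n => hc0.trans_le ?_
    unfold freq
    refine div_nonneg (Finset.sum_nonneg fun i _ => Set.indicator_nonneg (fun _ _ => zero_le_one) _)
      (Nat.cast_nonneg n)
  let I := {t : Finset B // ∀ s ∈ t, (s : Set X) ⊆ U}
  have hU' : U = ⋃ t : I, ⋃ s ∈ t.1, (s : Set X) := by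
    ext z
    simp only [Set.mem_iUnion]
    constructor
    · intro hz
      obtain ⟨v, hv, hzv, hvU⟩ := hB.exists_subset_of_mem_open hz hU
      exact ⟨⟨{⟨v, hv⟩}, by simpa using hvU⟩, ⟨v, hv⟩, by simp, hzv⟩
    · rintro ⟨t, s, hs, hz⟩
      exact t.2 s hs hz
  have hdir : Directed (· ⊆ ·) (fun t : I => ⋃ s ∈ t.1, (s : Set X)) := by
    classical
    intro a b
    refine ⟨⟨a.1 ∪ b.1, ?_⟩, ?_, ?_⟩
    · intro s hs
      rcases Finset.mem_union.1 hs with h | h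
      exacts [a.2 s h, b.2 s h]
    · exact Set.biUnion_subset_biUnion_left fun s hs => Finset.mem_union_left _ hs
    · exact Set.biUnion_subset_biUnion_left fun s hs => Finset.mem_union_right _ hs
  have hm := hdir.measure_iUnion (μ := μ)
  rw [← hU'] at hm
  have hc' : ENNReal.ofReal c < μ U := by
    rw [ENNReal.ofReal_lt_iff_lt_toReal hc0 (measure_ne_top _ _)]
    exact hc
  rw [hm, lt_iSup_iff] at hc'
  obtain ⟨t, ht⟩ := hc'
  rw [ENNReal.ofReal_lt_iff_lt_toReal hc0 (measure_ne_top _ _)] at ht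
  filter_upwards [(hx t.1).eventually_const_lt ht] with n hn
  refine hn.trans_le (freq_mono x ?_ n)
  exact Set.iUnion₂_subset fun s hs => t.2 s hs

lemma exists_ext {X Y : Type*} [MeasurableSpace X] [MetricSpace X] [CompleteSpace X] [BorelSpace X]
    [MeasurableSpace Y] [MetricSpace Y] [BorelSpace Y] (x : ℕ → X) (y : ℕ → Y)
    (hxy : ∀ i j, dist (x i) (x j) ≤ dist (y i) (y j)) :
    ∃ τ : Y → X, Measurable τ ∧ (∀ i, τ (y i) = x i) ∧
      ∀ p ∈ closure (Set.range y), ∀ q ∈ closure (Set.range y), dist (τ p) (τ q) ≤ dist p q := by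
  have h1 : ∀ p ∈ closure (Set.range y), ∃ z : X, ∀ i, dist z (x i) ≤ dist p (y i) := by
    intro p hp
    obtain ⟨u, hu, hlim⟩ := mem_closure_iff_seq_limit.1 hp
    choose k hk using hu
    have hlim' : Tendsto (fun n => y (k n)) atTop (𝓝 p) := by simpa only [hk] using hlim
    have hc : CauchySeq (fun n => x (k n)) := by
      rw [Metric.cauchySeq_iff]
      intro ε hε
      obtain ⟨N, hN⟩ := Metric.cauchySeq_iff.1 hlim'.cauchySeq ε hε
      exact ⟨N, fun m hm n hn => (hxy _ _).trans_lt (hN m hm n hn)⟩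
    obtain ⟨z, hz⟩ := cauchySeq_tendsto_of_complete hc
    refine ⟨z, fun i => ?_⟩
    exact le_of_tendsto_of_tendsto' (hz.dist tendsto_const_nhds) (hlim'.dist tendsto_const_nhds)
      (fun n => hxy _ _)
  have hne : Nonempty X := ⟨x 0⟩
  choose! τ hτ using h1
  have hτy : ∀ i, τ (y i) = x i := by
    intro i
    have := hτ (y i) (subset_closure ⟨i, rfl⟩) i
    rw [dist_self] at this
    exact dist_le_zero.1 this
  have hlip : ∀ p ∈ closure (Set.range y), ∀ q ∈ closure (Set.range y),
      dist (τ p) (τ q) ≤ dist p q := by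
    intro p hp q hq
    refine le_of_forall_pos_le_add fun ε hε => ?_
    obtain ⟨_, ⟨i, rfl⟩, hi⟩ := Metric.mem_closure_iff.1 hq (ε / 2) (half_pos hε)
    have a := hτ p hp i
    have b := hτ q hq i
    have c := dist_triangle_right (τ p) (τ q) (x i)
    have d := dist_triangle p q (y i)
    linarith
  classical
  refine ⟨(closure (Set.range y)).piecewise τ (fun _ => x 0), ?_, ?_, ?_⟩
  · refine ContinuousOn.measurable_piecewise ?_ continuousOn_const isClosed_closure.measurableSet
    have : LipschitzOnWith 1 τ (closure (Set.range y)) :=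
      LipschitzOnWith.of_dist_le_mul (by simpa using hlip)
    exact this.continuousOn
  · intro i
    rw [Set.piecewise_eq_of_mem _ _ _ (subset_closure (Set.mem_range_self i)), hτy]
  · intro p hp q hq
    rw [Set.piecewise_eq_of_mem _ _ _ hp, Set.piecewise_eq_of_mem _ _ _ hq]
    exact hlip p hp q hq

lemma freq_eq {X Y : Type*} (x : ℕ → X) (y : ℕ → Y) (V : Set X) (W : Set Y)
    (h : ∀ i, x i ∈ V ↔ y i ∈ W) (n : ℕ) : freq x V n = freq y W n := by
  classical
  unfold freq
  congr 1
  refine Finset.sum_congr rfl fun i _ => ?_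
  simp only [Set.indicator_apply, h i]

lemma freq_add_le {X : Type*} (x : ℕ → X) (V W : Set X) (h : Disjoint V W) (n : ℕ) :
    freq x V n + freq x W n ≤ 1 := by
  unfold freq
  rw [← add_div, ← Finset.sum_add_distrib]
  refine div_le_one_of_le₀ ?_ (Nat.cast_nonneg n)
  calc _ ≤ ∑ i ∈ Finset.range n, (1 : ℝ) := Finset.sum_le_sum fun i _ => ?_
    _ = n := by simp
  by_cases hV : x i ∈ V
  · have : x i ∉ W := Set.disjoint_left.1 h hV
    simp [hV, this]
  · by_cases hW : x i ∈ W <;> simp [hV, hW]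

lemma of_good {X Y : Type*} [MeasurableSpace X] [MetricSpace X] [CompleteSpace X] [BorelSpace X]
    [MeasurableSpace Y] [MetricSpace Y] [BorelSpace Y]
    (μX : Measure X) (μY : Measure Y)
    [IsProbabilityMeasure μX] [IsProbabilityMeasure μY] (x : ℕ → X) (y : ℕ → Y)
    (hx : Good μX x) (hy : Good μY y)
    (hxy : ∀ i j, dist (x i) (x j) ≤ dist (y i) (y j)) : LeMetric μX μY := by
  obtain ⟨τ, hτm, hτy, hlip⟩ := exists_ext x y hxy
  set D := closure (Set.range y) with hD
  have hyD : ∀ i, y i ∈ D := fun i => subset_closure ⟨i, rfl⟩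
  have hDc : μY Dᶜ = 0 := by
    by_contra hne
    have hpos : 0 < μY.real Dᶜ := ENNReal.toReal_pos hne (measure_ne_top _ _)
    obtain ⟨n, hn⟩ := (hy Dᶜ isClosed_closure.isOpen_compl 0 hpos).exists
    have : freq y Dᶜ n = 0 := by
      unfold freq
      simp [hyD]
    linarith
  have hsupp : msupp μY ⊆ D := by
    intro p hp
    by_contra hpD
    obtain ⟨ε, hε, hb⟩ := Metric.isOpen_iff.1 isClosed_closure.isOpen_compl p hpD
    exact (hp ε hε).ne' (measure_mono_null hb hDc)
  have hcont : ContinuousOn τ D := by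
    have : LipschitzOnWith 1 τ D := LipschitzOnWith.of_dist_le_mul (by simpa using hlip)
    exact this.continuousOn
  -- key inequality
  have key : ∀ V F : Set X, IsOpen V → IsClosed F → V ⊆ F → μY (τ ⁻¹' V) ≤ μX F := by
    intro V F hV hF hVF
    obtain ⟨W, hW, hWV⟩ := (_root_.continuousOn_iff'.1 hcont) V hV
    have e : μY (τ ⁻¹' V) = μY W := by
      refine measure_congr ?_
      have : ∀ᵐ p ∂μY, p ∈ D := by
        rw [ae_iff]; exact hDc
      filter_upwards [this] with p hp
      have := Set.ext_iff.1 hWV p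
      simp only [Set.mem_inter_iff, hp, and_true] at this
      exact propext this
    rw [e]
    by_contra! hlt
    have hlt' : μX.real F < μY.real W :=
      (ENNReal.toReal_lt_toReal (measure_ne_top _ _) (measure_ne_top _ _)).2 hlt
    have hFc : μX.real Fᶜ = 1 - μX.real F := probReal_compl_eq_one_sub hF.measurableSet
    set δ := (μY.real W - μX.real F) / 2 with hδ
    have hδ0 : 0 < δ := by rw [hδ]; linarith
    obtain ⟨n, h1, h2⟩ := ((hy W hW (μY.real W - δ) (by linarith)).and
      (hx Fᶜ hF.isOpen_compl (μX.real Fᶜ - δ) (by linarith))).exists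
    have h3 : freq x V n = freq y W n := by
      refine freq_eq x y V W (fun i => ?_) n
      have := Set.ext_iff.1 hWV (y i)
      simpa only [Set.mem_inter_iff, hyD i, and_true, Set.mem_preimage, hτy] using this
    have h4 := freq_add_le x V Fᶜ (Set.disjoint_compl_right_iff_subset.2 hVF) n
    linarith
  haveI : IsProbabilityMeasure (μY.map τ) := Measure.isProbabilityMeasure_map hτm.aemeasurable
  have hclosed : ∀ F : Set X, IsClosed F → μY.map τ F ≤ μX F := by
    intro F hF
    rw [Measure.map_apply hτm hF.measurableSet]
    have ht := (tendsto_measure_cthickening_of_isClosed (μ := μX) (s := F)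
      ⟨1, one_pos, measure_ne_top _ _⟩ hF).mono_left (nhdsWithin_le_nhds (s := Set.Ioi 0))
    refine ge_of_tendsto ht ?_
    filter_upwards [self_mem_nhdsWithin] with δ hδ
    refine (measure_mono (Set.preimage_mono (Metric.self_subset_thickening hδ F))).trans ?_
    exact key _ _ Metric.isOpen_thickening Metric.isClosed_cthickening
      (Metric.thickening_subset_cthickening _ _)
  have hmap : μY.map τ = μX := by
    refine Measure.eq_of_le_of_isProbabilityMeasure (Measure.le_iff.2 fun A hA => ?_)
    rw [hA.measure_eq_iSup_isClosed_of_ne_top (measure_ne_top _ _)]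
    exact iSup₂_le fun F hFA => iSup_le fun hF => (hclosed F hF).trans (measure_mono hFA)
  refine ⟨τ, hτm, ?_, hmap, fun p hp q hq => hlip p (hsupp hp) q (hsupp hq)⟩
  intro p hp ε hε
  rw [← hmap, Measure.map_apply hτm measurableSet_ball]
  refine (hp ε hε).trans_le ?_
  rw [← measure_inter_add_sdiff₀ (ball p ε) isClosed_closure.measurableSet.nullMeasurableSet (t := D)]
  have h0 : μY (ball p ε \ D) = 0 := measure_mono_null (fun q hq => hq.2) hDc
  rw [h0, add_zero]
  refine measure_mono fun q hq => ?_
  exact (hlip q hq.2 p (hsupp hp)).trans_lt hq.1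

instance : Countable NIdx := by unfold NIdx; infer_instance

instance : BorelSpace (NIdx → ℝ) :=
  (Pi.borelSpace : @BorelSpace (NIdx → ℝ) _ MeasurableSpace.pi)

lemma continuous_distMat {X : Type*} [MetricSpace X] :
    Continuous (distMatMapInf : (ℕ → X) → NIdx → ℝ) :=
  continuous_pi fun p => (continuous_apply p.val.1).dist (continuous_apply p.val.2)

lemma measurable_distMat {X : Type*} [MeasurableSpace X] [MetricSpace X]
    [SecondCountableTopology X] [BorelSpace X] :
    Measurable (distMatMapInf : (ℕ → X) → NIdx → ℝ) :=
  continuous_distMat.measurable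

/-- if the infinite distance matrix measure of `(X, r_X, μ_X)` is dominated by
that of `(Y, r_Y, μ_Y)` on every increasing Borel set, then `(X, r_X, μ_X) ≼_metric
(Y, r_Y, μ_Y)`. Here `PX = μX^{⊗ℕ}` and `PY = μY^{⊗ℕ}` are the countable product measures
and the infinite distance matrix measures are their pushforwards under `distMatMapInf`. -/
theorem stmt2 {X Y : Type*} [MeasurableSpace X] [MetricSpace X] [SecondCountableTopology X] [CompleteSpace X] [BorelSpace X] [MeasurableSpace Y] [MetricSpace Y] [SecondCountableTopology Y] [CompleteSpace Y] [BorelSpace Y]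
    (μX : Measure X) (μY : Measure Y)
    [IsProbabilityMeasure μX] [IsProbabilityMeasure μY]
    (PX : Measure (ℕ → X)) (PY : Measure (ℕ → Y))
    (hPX : IsInfiniteProduct μX PX) (hPY : IsInfiniteProduct μY PY)
    (h : ∀ A : Set (NIdx → ℝ), MeasurableSet A → (∀ a ∈ A, ∀ b, a ≤ b → b ∈ A) →
      PX.map distMatMapInf A ≤ PY.map distMatMapInf A) :
    LeMetric μX μY := by
  haveI := hPX.1
  haveI := hPY.1
  -- a compact set of typical sequences
  have hgY := ae_good μY PY hPY
  obtain ⟨G, hGsub, hGm, hG⟩ : ∃ G : Set (ℕ → Y), (∀ y ∈ G, Good μY y) ∧ MeasurableSet G ∧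
      0 < PY G := by
    refine ⟨(toMeasurable PY {y | ¬ Good μY y})ᶜ, ?_, (measurableSet_toMeasurable _ _).compl, ?_⟩
    · intro y hy
      by_contra hn
      exact hy (subset_toMeasurable _ _ hn)
    · rw [prob_compl_eq_one_sub (measurableSet_toMeasurable _ _), measure_toMeasurable,
        ae_iff.1 hgY]
      simp
  obtain ⟨K, hKG, hK, hKpos⟩ := hGm.exists_lt_isCompact_of_ne_top (measure_ne_top PY G) hG
  set B : Set (NIdx → ℝ) := {a | ∃ y ∈ K, a ≤ distMatMapInf y} with hB
  have hBc : IsClosed B := by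
    haveI : CompactSpace K := isCompact_iff_compactSpace.1 hK
    have hc : IsClosed {p : (NIdx → ℝ) × K | ∀ i, p.1 i ≤ distMatMapInf p.2.1 i} := by
      simp only [Set.setOf_forall]
      refine isClosed_iInter fun i => isClosed_le ?_ ?_
      · exact (continuous_apply i).comp continuous_fst
      · exact (continuous_apply i).comp
          (continuous_distMat.comp (continuous_subtype_val.comp continuous_snd))
    have := isClosedMap_fst_of_compactSpace _ hc
    convert this using 1
    ext a
    constructor
    · rintro ⟨y, hy, h⟩
      exact ⟨(a, ⟨y, hy⟩), h, rfl⟩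
    · rintro ⟨⟨a', y⟩, h, rfl⟩
      exact ⟨y.1, y.2, h⟩
  have hBm : MeasurableSet B := hBc.measurableSet
  have hle := h Bᶜ hBm.compl (by
    intro a ha b hab hb
    obtain ⟨y, hy, hby⟩ := hb
    exact ha ⟨y, hy, hab.trans hby⟩)
  rw [Measure.map_apply measurable_distMat hBm.compl,
    Measure.map_apply measurable_distMat hBm.compl] at hle
  have hlt : PY (distMatMapInf ⁻¹' Bᶜ) < 1 := by
    rw [Set.preimage_compl, prob_compl_eq_one_sub (measurable_distMat hBm)]
    refine ENNReal.sub_lt_self ENNReal.one_ne_top one_ne_zero (ne_of_gt ?_)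
    exact hKpos.trans_le (measure_mono fun y hy => ⟨y, hy, le_rfl⟩)
  have hX : ∃ x, Good μX x ∧ distMatMapInf x ∈ B := by
    by_contra! hn
    have : PX (distMatMapInf ⁻¹' Bᶜ) = 1 := by
      rw [← mem_ae_iff_prob_eq_one (measurable_distMat hBm.compl)]
      filter_upwards [ae_good μX PX hPX] with x hx
      exact hn x hx
    exact absurd (this ▸ hle) (not_le.2 hlt)
  obtain ⟨x, hx, y, hy, hxy⟩ := hX
  refine of_good μX μY x y hx (hGsub y (hKG hy)) fun i j => ?_
  rcases lt_trichotomy i j with hij | rfl | hij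
  · exact hxy ⟨(i, j), hij⟩
  · simp
  · rw [dist_comm, dist_comm (y i)]
    exact hxy ⟨(j, i), hij⟩

end MMOrder
end

section
/- Let (X, r_X, μ_X) and (Y, r_Y, μ_Y) be probability mm spaces with (X, r_X, μ_X) ≼_metric (Y, r_Y, μ_Y) and (Y, r_Y, μ_Y) ≼_metric (X, r_X, μ_X). Then (X, r_X, μ_X) and (Y, r_Y, μ_Y) are equivalent, i.e. there exists a measure-preserving isometry between their supports. -/
open MeasureTheory Metric Filter Topology

namespace MMOrder

noncomputable def gfun (d : ℝ) : ENNReal := ENNReal.ofReal (1 - Real.exp (-d))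

theorem gfun_meas : Measurable gfun := by
  unfold gfun; fun_prop

theorem gfun_mono {a b : ℝ} (h : a ≤ b) : gfun a ≤ gfun b := by
  unfold gfun
  apply ENNReal.ofReal_le_ofReal
  have := Real.exp_le_exp.2 (neg_le_neg h)
  linarith

theorem gfun_le_one (a : ℝ) : gfun a ≤ 1 := by
  unfold gfun
  rw [← ENNReal.ofReal_one]
  apply ENNReal.ofReal_le_ofReal
  have := Real.exp_pos (-a)
  linarith

theorem gfun_inj {a b : ℝ} (ha : 0 ≤ a) (hb : 0 ≤ b) (h : gfun a = gfun b) : a = b := by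
  unfold gfun at h
  have h1 : Real.exp (-a) ≤ 1 := by rw [Real.exp_le_one_iff]; linarith
  have h2 : Real.exp (-b) ≤ 1 := by rw [Real.exp_le_one_iff]; linarith
  rw [ENNReal.ofReal_eq_ofReal_iff (by linarith) (by linarith)] at h
  have : Real.exp (-a) = Real.exp (-b) := by linarith
  have := Real.exp_injective this
  linarith

theorem ae_mem_msupp {X : Type*} [MeasurableSpace X] [MetricSpace X]
    [SecondCountableTopology X] (μ : Measure X) : ∀ᵐ x ∂μ, x ∈ msupp μ := by
  have h : msupp μ = μ.support := by
    ext x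
    rw [Metric.nhds_basis_ball.mem_measureSupport]
    rfl
  rw [h]
  exact Measure.support_mem_ae

theorem ae_mem_msupp_prod {X : Type*} [MeasurableSpace X] [MetricSpace X]
    [SecondCountableTopology X] (μ : Measure X) [SFinite μ] :
    ∀ᵐ p ∂(μ.prod μ), p.1 ∈ msupp μ ∧ p.2 ∈ msupp μ := by
  have h := ae_mem_msupp μ
  exact (Measure.quasiMeasurePreserving_fst.ae h).and (Measure.quasiMeasurePreserving_snd.ae h)

noncomputable def gInt {X : Type*} [MeasurableSpace X] [MetricSpace X] (μ : Measure X) : ENNReal :=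
  ∫⁻ p, gfun (dist p.1 p.2) ∂(μ.prod μ)

theorem gInt_map {X Y : Type*} [MeasurableSpace X] [MetricSpace X] [SecondCountableTopology X]
    [BorelSpace X] [MeasurableSpace Y] [MetricSpace Y]
    (μX : Measure X) (μY : Measure Y) [IsProbabilityMeasure μX] [IsProbabilityMeasure μY]
    {τ : Y → X} (hm : Measurable τ) (hτ : μY.map τ = μX) :
    gInt μX = ∫⁻ p, gfun (dist (τ p.1) (τ p.2)) ∂(μY.prod μY) := by
  have h : MeasurePreserving (Prod.map τ τ) (μY.prod μY) (μX.prod μX) :=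
    MeasurePreserving.prod ⟨hm, hτ⟩ ⟨hm, hτ⟩
  unfold gInt
  exact (h.lintegral_comp (gfun_meas.comp measurable_dist)).symm

theorem gInt_le {X Y : Type*} [MeasurableSpace X] [MetricSpace X] [SecondCountableTopology X]
    [BorelSpace X] [MeasurableSpace Y] [MetricSpace Y] [SecondCountableTopology Y]
    (μX : Measure X) (μY : Measure Y) [IsProbabilityMeasure μX] [IsProbabilityMeasure μY]
    (h : LeMetric μX μY) : gInt μX ≤ gInt μY := by
  obtain ⟨τ, hm, -, hτ, hl⟩ := h
  rw [gInt_map μX μY hm hτ]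
  apply lintegral_mono_ae
  filter_upwards [ae_mem_msupp_prod μY] with p hp
  exact gfun_mono (hl _ hp.1 _ hp.2)

/-- antisymmetry of `≼_metric` on probability mm spaces, up to equivalence. -/
theorem stmt3 {X Y : Type*} [MeasurableSpace X] [MetricSpace X] [SecondCountableTopology X] [CompleteSpace X] [BorelSpace X] [MeasurableSpace Y] [MetricSpace Y] [SecondCountableTopology Y] [CompleteSpace Y] [BorelSpace Y]
    (μX : Measure X) (μY : Measure Y)
    [IsProbabilityMeasure μX] [IsProbabilityMeasure μY]
    (h1 : LeMetric μX μY) (h2 : LeMetric μY μX) :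
    MMEquiv μX μY := by
  obtain ⟨σ, hm, -, hσ, hl⟩ := id h2
  refine ⟨σ, hm, hσ, ?_⟩
  have hle := gInt_le μX μY h1
  rw [gInt_map μY μX hm hσ] at hle
  have hae : (fun p : X × X => gfun (dist (σ p.1) (σ p.2))) =ᵐ[μX.prod μX]
      fun p => gfun (dist p.1 p.2) := by
    refine ae_eq_of_ae_le_of_lintegral_le ?_ ?_ ?_ hle
    · filter_upwards [ae_mem_msupp_prod μX] with p hp
      exact gfun_mono (hl _ hp.1 _ hp.2)
    · refine ne_top_of_le_ne_top ENNReal.one_ne_top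
        (le_trans (lintegral_mono (fun p => gfun_le_one _)) ?_)
      simp
    · exact (gfun_meas.comp measurable_dist).aemeasurable
  intro x₁ hx₁ x₂ hx₂
  refine le_antisymm (hl _ hx₁ _ hx₂) (le_of_forall_pos_le_add fun ε hε => ?_)
  have hpos : (μX.prod μX) (Metric.ball x₁ (ε / 4) ×ˢ Metric.ball x₂ (ε / 4)) ≠ 0 := by
    rw [Measure.prod_prod]
    exact mul_ne_zero (hx₁ _ (by positivity)).ne' (hx₂ _ (by positivity)).ne'
  obtain ⟨p, hp, hq, hs⟩ : ∃ p ∈ Metric.ball x₁ (ε / 4) ×ˢ Metric.ball x₂ (ε / 4),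
      gfun (dist (σ p.1) (σ p.2)) = gfun (dist p.1 p.2) ∧ p.1 ∈ msupp μX ∧ p.2 ∈ msupp μX := by
    by_contra! hcon
    apply hpos
    refine measure_mono_null ?_ (ae_iff.1 (hae.and (ae_mem_msupp_prod μX)))
    intro p hp hn
    exact hcon p hp hn.1 hn.2.1 hn.2.2
  have he := gfun_inj dist_nonneg dist_nonneg hq
  have b1 : dist p.1 x₁ < ε / 4 := hp.1
  have b2 : dist p.2 x₂ < ε / 4 := hp.2
  have l1 := hl _ hs.1 _ hx₁
  have l2 := hl _ hs.2 _ hx₂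
  have t1 := dist_triangle4 x₁ p.1 p.2 x₂
  have t2 := dist_triangle4 (σ p.1) (σ x₁) (σ x₂) (σ p.2)
  rw [dist_comm x₁ p.1] at t1
  rw [dist_comm (σ x₂) (σ p.2)] at t2
  linarith

end MMOrder
end

section
/- Let (X_n, r_n, μ_n), (Y_n, ρ_n, λ_n), n ∈ ℕ, and (X, r, μ), (Y, ρ, λ) be probability mm spaces such that (X_n, r_n, μ_n) converges Gromov-weakly to (X, r, μ), (Y_n, ρ_n, λ_n) converges Gromov-weakly to (Y, ρ, λ), and (X_n, r_n, μ_n) ≼_metric (Y_n, ρ_n, λ_n) for every n. Then (X, r, μ) ≼_metric (Y, ρ, λ). -/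
open MeasureTheory Metric Filter Topology

namespace MMOrder

section helpers

variable {X : Type} [MeasurableSpace X] [MetricSpace X] [SecondCountableTopology X]
  [CompleteSpace X] [BorelSpace X]

/-- The empirical measure of the first `N+1` points. -/
noncomputable def empM (x : ℕ → X) (N : ℕ) : Measure X :=
  ((N + 1 : ℕ) : ENNReal)⁻¹ • ∑ i ∈ Finset.range (N + 1), Measure.dirac (x i)

lemma empM_prob (x : ℕ → X) (N : ℕ) : IsProbabilityMeasure (empM x N) := by
  constructor
  simp only [empM, Measure.smul_apply, Measure.finsetSum_apply, measure_univ, smul_eq_mul,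
    Finset.sum_const, Finset.card_range, nsmul_eq_mul, mul_one]
  exact ENNReal.inv_mul_cancel (by simp) (by simp)

/-- The empirical measure as a probability measure. -/
noncomputable def emp (x : ℕ → X) (N : ℕ) : ProbabilityMeasure X := ⟨empM x N, empM_prob x N⟩

lemma emp_integral (x : ℕ → X) (N : ℕ) (f : X → ℝ) :
    ∫ z, f z ∂(emp x N : Measure X) =
      (∑ i ∈ Finset.range (N + 1), f (x i)) / ((N + 1 : ℕ) : ℝ) := by
  change ∫ z, f z ∂(empM x N) = _
  rw [empM, integral_smul_measure, integral_finsetSum_measure]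
  · simp only [integral_dirac, ENNReal.toReal_inv, ENNReal.toReal_natCast, smul_eq_mul]
    rw [div_eq_inv_mul]
  · intro i _
    exact integrable_dirac (by simp)

lemma emp_real (x : ℕ → X) (N : ℕ) (s : Set X) (hs : MeasurableSet s) :
    ((emp x N) s : ℝ) =
      (∑ i ∈ Finset.range (N + 1), s.indicator (fun _ => (1 : ℝ)) (x i)) / ((N + 1 : ℕ) : ℝ) := by
  rw [← emp_integral, integral_indicator hs]
  simp [Measure.real, ProbabilityMeasure.coeFn_def]
  rfl

/-- Equidistribution. -/
def Eqd (μ : ProbabilityMeasure X) (x : ℕ → X) : Prop :=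
  Tendsto (emp x) atTop (𝓝 μ)

lemma ae_freq (μ : ProbabilityMeasure X) (s : Set X) (hs : MeasurableSet s) :
    ∀ᵐ x ∂(Measure.infinitePi (fun _ : ℕ => (μ : Measure X))),
      Tendsto (fun N => emp x N s) atTop (𝓝 (μ s)) := by
  have hm : Measurable (s.indicator (fun _ => (1 : ℝ))) := measurable_const.indicator hs
  have hid : ∀ i : ℕ, (Measure.infinitePi (fun _ : ℕ => (μ : Measure X))).map
      (fun x => x i) = μ := fun i => Measure.infinitePi_map_eval _ i
  have hind := ProbabilityTheory.iIndepFun_infinitePi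
    (P := fun _ : ℕ => (μ : Measure X)) (X := fun _ : ℕ => s.indicator (fun _ => (1 : ℝ)))
    (fun _ => hm)
  have := ProbabilityTheory.strong_law_ae_real
    (μ := Measure.infinitePi (fun _ : ℕ => (μ : Measure X)))
    (fun i x => s.indicator (fun _ => (1 : ℝ)) (x i)) ?_ ?_ ?_
  · filter_upwards [this] with x hx
    have hx' := (tendsto_add_atTop_iff_nat 1).2 hx
    rw [← NNReal.tendsto_coe]
    simp_rw [emp_real x _ s hs]
    convert hx' using 2
    rw [← integral_map (φ := fun x : ℕ → X => x 0) (measurable_pi_apply 0).aemeasurable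
      (hm.aestronglyMeasurable), hid, integral_indicator hs]
    simp [Measure.real, ProbabilityMeasure.coeFn_def]
    rfl
  · refine Integrable.of_bound (C := 1) ?_ ?_
    · exact (hm.comp (measurable_pi_apply 0)).aestronglyMeasurable
    · refine Eventually.of_forall fun x => ?_
      by_cases h : x 0 ∈ s <;> simp [h]
  · intro i j hij
    exact hind.indepFun hij
  · intro i
    have h : ProbabilityTheory.IdentDistrib (fun x : ℕ → X => x i) (fun x : ℕ → X => x 0)
      (Measure.infinitePi (fun _ : ℕ => (μ : Measure X)))
      (Measure.infinitePi (fun _ : ℕ => (μ : Measure X))) :=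
      ⟨(measurable_pi_apply i).aemeasurable, (measurable_pi_apply 0).aemeasurable, by rw [hid, hid]⟩
    exact h.comp hm

lemma ae_eqd (μ : ProbabilityMeasure X) :
    ∀ᵐ x ∂(Measure.infinitePi (fun _ : ℕ => (μ : Measure X))), Eqd μ x := by
  let b := TopologicalSpace.countableBasis X
  have hb := TopologicalSpace.isBasis_countableBasis X
  let S : Set (Set X) := (fun F : Set (Set X) => ⋂₀ F) '' {F | F.Finite ∧ F ⊆ b}
  have hS : S.Countable :=
    (Set.countable_ofPred_finite_subset (TopologicalSpace.countable_countableBasis X)).image _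
  have hopen : ∀ s ∈ S, IsOpen s := by
    rintro _ ⟨F, ⟨hF, hFb⟩, rfl⟩
    exact hF.isOpen_sInter fun t ht => hb.isOpen (hFb ht)
  have hae : ∀ᵐ x ∂(Measure.infinitePi (fun _ : ℕ => (μ : Measure X))),
      ∀ s ∈ S, Tendsto (fun N => emp x N s) atTop (𝓝 (μ s)) :=
    (ae_ball_iff hS).2 fun s hs => ae_freq μ s (hopen s hs).measurableSet
  filter_upwards [hae] with x hx
  refine IsPiSystem.tendsto_probabilityMeasure_of_tendsto_of_mem (S := S) ?_
    (fun s hs => (hopen s hs).measurableSet) ?_ hx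
  · rintro _ ⟨F, ⟨hF, hFb⟩, rfl⟩ _ ⟨G, ⟨hG, hGb⟩, rfl⟩ _
    exact ⟨F ∪ G, ⟨hF.union hG, Set.union_subset hFb hGb⟩, Set.sInter_union F G⟩
  · intro u hu z hz
    obtain ⟨t, ht, hzt, htu⟩ := hb.exists_subset_of_mem_open hz hu
    exact ⟨t, ⟨{t}, ⟨Set.finite_singleton t, by simpa using ht⟩, by simp⟩,
      (hb.isOpen ht).mem_nhds hzt, htu⟩

lemma exists_compact_eqd (μ : ProbabilityMeasure X) :
    ∃ K : Set (ℕ → X), IsCompact K ∧ (∀ x ∈ K, Eqd μ x) ∧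
      ENNReal.ofReal (9/10) < Measure.infinitePi (fun _ : ℕ => (μ : Measure X)) K := by
  set P := Measure.infinitePi (fun _ : ℕ => (μ : Measure X))
  have h : P {x | Eqd μ x}ᶜ = 0 := ae_eqd μ
  have hm := measurableSet_toMeasurable P {x | Eqd μ x}ᶜ
  have h1 : P (toMeasurable P {x | Eqd μ x}ᶜ)ᶜ = 1 := by
    rw [prob_compl_eq_one_iff hm, measure_toMeasurable, h]
  obtain ⟨K, hK, hKc, hlt⟩ := hm.compl.exists_lt_isCompact (μ := P)
    (r := ENNReal.ofReal (9/10)) (by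
      rw [h1]; exact ENNReal.ofReal_lt_one.2 (by norm_num))
  refine ⟨K, hKc, fun x hx => ?_, hlt⟩
  by_contra hc
  exact hK hx (subset_toMeasurable P _ hc)

lemma ae_msupp (μ : Measure X) : ∀ᵐ x ∂μ, x ∈ msupp μ := by
  have : μ.support ∈ ae μ := Measure.support_mem_ae
  filter_upwards [this] with x hx ε hε
  exact (Measure.mem_support_iff_forall x).1 hx _ (Metric.ball_mem_nhds x hε)

lemma eqd_closure (μ : ProbabilityMeasure X) (x : ℕ → X) (hx : Eqd μ x) :
    (μ : Measure X) (closure (Set.range x))ᶜ = 0 := by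
  have h := ProbabilityMeasure.le_liminf_measure_open_of_tendsto hx
    (isClosed_closure (s := Set.range x)).isOpen_compl
  have h0 : ∀ N, (emp x N : Measure X) (closure (Set.range x))ᶜ = 0 := by
    intro N
    change empM x N _ = 0
    have : ∀ i, x i ∈ closure (Set.range x) := fun i => subset_closure ⟨i, rfl⟩
    simp [empM, Measure.dirac_apply' _ isClosed_closure.measurableSet.compl, this]
  simp only [h0, liminf_const] at h
  exact le_antisymm h bot_le

end helpers

section construct

variable {X Y : Type} [MeasurableSpace X] [MetricSpace X] [SecondCountableTopology X]
  [CompleteSpace X] [BorelSpace X] [MeasurableSpace Y] [MetricSpace Y] [SecondCountableTopology Y]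
  [CompleteSpace Y] [BorelSpace Y]

lemma exists_ext_s4 (x : ℕ → X) (y : ℕ → Y) (hxy : ∀ i j, dist (x i) (x j) ≤ dist (y i) (y j))
    (w : Y) (hw : w ∈ closure (Set.range y)) : ∃ z : X, ∀ i, dist z (x i) ≤ dist w (y i) := by
  obtain ⟨u, hu, hlim⟩ := mem_closure_iff_seq_limit.1 hw
  choose k hk using hu
  have hyl : Tendsto (fun n => y (k n)) atTop (𝓝 w) := by simpa only [hk] using hlim
  have hc : CauchySeq (fun n => x (k n)) := by
    have := hyl.cauchySeq
    rw [Metric.cauchySeq_iff] at this ⊢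
    intro ε hε
    obtain ⟨N, hN⟩ := this ε hε
    exact ⟨N, fun m hm n hn => (hxy _ _).trans_lt (hN m hm n hn)⟩
  obtain ⟨z, hz⟩ := cauchySeq_tendsto_of_complete hc
  exact ⟨z, fun i => le_of_tendsto_of_tendsto' (hz.dist tendsto_const_nhds)
    (hyl.dist tendsto_const_nhds) fun n => hxy _ _⟩

lemma leMetric_of_eqd (μ : ProbabilityMeasure X) (ν : ProbabilityMeasure Y)
    (x : ℕ → X) (y : ℕ → Y) (hx : Eqd μ x) (hy : Eqd ν y)
    (hxy : ∀ i j, dist (x i) (x j) ≤ dist (y i) (y j)) :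
    LeMetric (μ : Measure X) (ν : Measure Y) := by
  classical
  set S := closure (Set.range y) with hSdef
  have hSc : IsClosed S := isClosed_closure
  have hSm : MeasurableSet S := hSc.measurableSet
  have hS0 : (ν : Measure Y) Sᶜ = 0 := eqd_closure ν y hy
  have hyS : ∀ i, y i ∈ S := fun i => subset_closure ⟨i, rfl⟩
  haveI : Nonempty X := ⟨x 0⟩
  choose! t ht using fun w (hw : w ∈ S) => exists_ext_s4 x y hxy w hw
  have hlip : ∀ a ∈ S, ∀ b ∈ S, dist (t a) (t b) ≤ dist a b := by
    intro a ha b hb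
    refine le_of_forall_pos_le_add fun ε hε => ?_
    obtain ⟨_, ⟨i, rfl⟩, hi⟩ := Metric.mem_closure_iff.1 ha (ε / 2) (by positivity)
    have h1 := ht a ha i
    have h2 := ht b hb i
    have h3 := dist_triangle_right (t a) (t b) (x i)
    have h4 := dist_triangle_left b (y i) a
    rw [dist_comm a b]
    rw [dist_comm a b] at h4
    linarith [dist_comm a b]
  have hty : ∀ i, t (y i) = x i := by
    intro i
    have := ht (y i) (hyS i) i
    rw [dist_self] at this
    exact dist_le_zero.1 this
  have htc : ContinuousOn t S :=
    (LipschitzOnWith.of_dist_le_mul (K := 1) (by simpa using hlip)).continuousOn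
  let τ : Y → X := S.piecewise t (fun _ => x 0)
  have hτm : Measurable τ := htc.measurable_piecewise continuousOn_const hSm
  have hτS : ∀ a ∈ S, τ a = t a := fun a ha => Set.piecewise_eq_of_mem _ _ _ ha
  have hsub : msupp (ν : Measure Y) ⊆ S := by
    intro a ha
    by_contra hc
    obtain ⟨ε, hε, hb⟩ := Metric.isOpen_iff.1 hSc.isOpen_compl a hc
    exact (ha ε hε).ne' (measure_mono_null hb hS0)
  have hSae : ∀ᵐ a ∂(ν : Measure Y), a ∈ S := hS0
  have hmap : (ν : Measure Y).map τ = μ := by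
    haveI := Measure.isProbabilityMeasure_map (μ := (ν : Measure Y)) hτm.aemeasurable
    refine ext_of_forall_integral_eq_of_IsFiniteMeasure fun g => ?_
    let g' : BoundedContinuousFunction S ℝ :=
      g.compContinuous ⟨S.restrict t, htc.restrict⟩
    obtain ⟨h, -, hh⟩ := BoundedContinuousFunction.exists_norm_eq_domRestrict_eq_of_closed g' hSc
    have hh' : ∀ a ∈ S, h a = g (t a) := fun a ha => DFunLike.congr_fun hh ⟨a, ha⟩
    have e1 : ∫ a, g (τ a) ∂(ν : Measure Y) = ∫ a, h a ∂(ν : Measure Y) := by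
      refine integral_congr_ae ?_
      filter_upwards [hSae] with a ha
      rw [hτS a ha, hh' a ha]
    rw [integral_map hτm.aemeasurable g.continuous.aestronglyMeasurable, e1]
    have l1 := (ProbabilityMeasure.tendsto_iff_forall_integral_tendsto.1 hy) h
    have l2 := (ProbabilityMeasure.tendsto_iff_forall_integral_tendsto.1 hx) g
    refine tendsto_nhds_unique l1 (l2.congr fun N => ?_)
    rw [emp_integral, emp_integral]
    congr 1
    exact Finset.sum_congr rfl fun i _ => by rw [hh' _ (hyS i), hty]
  refine ⟨τ, hτm, ?_, hmap, ?_⟩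
  · intro a ha ε hε
    rw [← hmap, Measure.map_apply hτm Metric.isOpen_ball.measurableSet]
    refine (ha ε hε).trans_le ?_
    refine measure_mono_ae ?_
    filter_upwards [hSae] with b hb hbe
    change dist (τ b) (τ a) < ε
    rw [hτS b hb, hτS a (hsub ha)]
    exact (hlip b hb a (hsub ha)).trans_lt hbe
  · intro a ha b hb
    rw [hτS b (hsub hb), hτS a (hsub ha)]
    exact hlip a (hsub ha) b (hsub hb)

end construct
section finstep

instance (m : ℕ) : Fintype (DIdx m) := by unfold DIdx; infer_instance
instance (m : ℕ) : BorelSpace (DIdx m → ℝ) :=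
  inferInstanceAs (BorelSpace ({p : Fin m × Fin m // p.1 < p.2} → ℝ))

/-- Bump function around a set. -/
noncomputable def bump {m : ℕ} (C : Set (DIdx m → ℝ)) (δ : ℝ) (v : DIdx m → ℝ) : ℝ :=
  max 0 (1 - Metric.infDist v C / δ)

lemma bump_cont {m : ℕ} (C : Set (DIdx m → ℝ)) (δ : ℝ) : Continuous (bump C δ) := by
  unfold bump
  have := Metric.continuous_infDist_pt C
  fun_prop

lemma bump_nonneg {m : ℕ} (C : Set (DIdx m → ℝ)) (δ : ℝ) (v) : 0 ≤ bump C δ v :=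
  le_max_left _ _

lemma bump_le {m : ℕ} (C : Set (DIdx m → ℝ)) (δ : ℝ) (hδ : 0 < δ) (v) : bump C δ v ≤ 1 := by
  have : 0 ≤ Metric.infDist v C / δ := div_nonneg Metric.infDist_nonneg hδ.le
  exact max_le zero_le_one (by linarith)

lemma bump_mem {m : ℕ} (C : Set (DIdx m → ℝ)) (δ : ℝ) (v) (hv : v ∈ C) : bump C δ v = 1 := by
  simp [bump, Metric.infDist_zero_of_mem hv]

lemma bump_pos {m : ℕ} (C : Set (DIdx m → ℝ)) (hC : C.Nonempty) (δ : ℝ) (hδ : 0 < δ) (v)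
    (h : 0 < bump C δ v) : ∃ c ∈ C, dist v c < δ := by
  apply (Metric.infDist_lt_iff hC).1
  by_contra hc
  push Not at hc
  have : 1 ≤ Metric.infDist v C / δ := (one_le_div hδ).2 hc
  have h2 : bump C δ v ≤ 0 := max_le le_rfl (by linarith)
  linarith

lemma distMatMap_cont {X : Type} [MetricSpace X] (m : ℕ) :
    Continuous (distMatMap m : (Fin m → X) → _) := by
  refine continuous_pi fun p => ?_
  unfold distMatMap
  fun_prop

lemma integral_nuM {X : Type} [MeasurableSpace X] [MetricSpace X] [SecondCountableTopology X]
    [BorelSpace X] (μ : Measure X) (m : ℕ) (φ : (DIdx m → ℝ) → ℝ) (hφ : Continuous φ) :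
    ∫ v, φ v ∂(nuM μ m) = ∫ x, φ (distMatMap m x) ∂(Measure.pi fun _ : Fin m => μ) := by
  unfold nuM
  rw [integral_map (distMatMap_cont m).measurable.aemeasurable hφ.aestronglyMeasurable]

lemma int_ge {X : Type} [MeasurableSpace X] [MetricSpace X] [SecondCountableTopology X]
    [BorelSpace X] (μ : Measure X) [IsProbabilityMeasure μ] (K : Set (ℕ → X)) (hK : IsCompact K)
    (hlt : ENNReal.ofReal (9/10) < Measure.infinitePi (fun _ : ℕ => μ) K) (m : ℕ)
    (δ : ℝ) (hδ : 0 < δ) :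
    9/10 < ∫ v, bump ((fun y : ℕ → X => distMatMap m (fun i => y i)) '' K) δ v ∂(nuM μ m) := by
  set C := (fun y : ℕ → X => distMatMap m (fun i : Fin m => y i)) '' K
  set P := Measure.infinitePi (fun _ : ℕ => μ)
  have hmap : P.map (fun (y : ℕ → X) (i : Fin m) => y i) = Measure.pi fun _ : Fin m => μ := by
    rw [← Measure.infinitePi_eq_pi]
    exact Measure.map_infinitePi_infinitePi_of_inj (P := fun _ : ℕ => μ)
      (f := fun i : Fin m => (i : ℕ)) Fin.val_injective
  have hmeas : Measurable (fun (y : ℕ → X) (i : Fin m) => y i) :=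
    measurable_pi_lambda _ fun i => measurable_pi_apply _
  have hcont : Continuous (fun x : Fin m → X => bump C δ (distMatMap m x)) := (bump_cont C δ).comp (distMatMap_cont (X := X) m)
  rw [integral_nuM _ _ _ (bump_cont C δ), ← hmap,
    integral_map hmeas.aemeasurable hcont.aestronglyMeasurable]
  have h1 : 9/10 < P.real K := by
    rw [Measure.real]
    exact (ENNReal.ofReal_lt_iff_lt_toReal (by norm_num) (measure_ne_top _ _)).1 hlt
  refine h1.trans_le ?_
  rw [← integral_indicator_one hK.measurableSet]
  refine integral_mono_of_nonneg ?_ ?_ ?_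
  · exact Eventually.of_forall fun y => Set.indicator_nonneg (by simp) _
  · refine Integrable.of_bound (C := 1) (hcont.measurable.comp hmeas).aestronglyMeasurable ?_
    refine Eventually.of_forall fun y => ?_
    rw [Real.norm_of_nonneg (bump_nonneg _ _ _)]
    exact bump_le C δ hδ _
  · refine Eventually.of_forall fun y => ?_
    by_cases hy : y ∈ K
    · simp only [Set.indicator_of_mem hy]
      exact (bump_mem C δ _ ⟨y, hy, rfl⟩).ge
    · simp only [Set.indicator_of_notMem hy]
      exact bump_nonneg _ _ _

end finstep

lemma fin_step (Z W : ℕ → MM) (A B : MM)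
    (hWp : ∀ n, IsProbabilityMeasure (W n).μ)
    (hAp : IsProbabilityMeasure A.μ) (hBp : IsProbabilityMeasure B.μ)
    (hZ : GromovWeakTendsto Z A) (hW : GromovWeakTendsto W B)
    (hle : ∀ n, LeMetric (Z n).μ (W n).μ)
    (KA : Set (ℕ → A.carrier)) (KB : Set (ℕ → B.carrier)) (hKA : IsCompact KA)
    (hKB : IsCompact KB)
    (hA : ENNReal.ofReal (9/10) < Measure.infinitePi (fun _ : ℕ => A.μ) KA)
    (hB : ENNReal.ofReal (9/10) < Measure.infinitePi (fun _ : ℕ => B.μ) KB)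
    (m : ℕ) (hm : 2 ≤ m) (δ : ℝ) (hδ : 0 < δ) :
    ∃ y ∈ KB, ∃ x ∈ KA, ∀ i j : ℕ, i < j → j < m →
      dist (x i) (x j) ≤ dist (y i) (y j) + 2 * δ := by
  set CA := (fun y : ℕ → A.carrier => distMatMap m (fun i : Fin m => y i)) '' KA with hCA
  set CB := (fun y : ℕ → B.carrier => distMatMap m (fun i : Fin m => y i)) '' KB with hCB
  have neA : CA.Nonempty := by
    refine Set.Nonempty.image _ (nonempty_of_measure_ne_zero (μ := Measure.infinitePi (fun _ : ℕ => A.μ)) ?_)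
    exact (bot_le.trans_lt hA).ne'
  have neB : CB.Nonempty := by
    refine Set.Nonempty.image _ (nonempty_of_measure_ne_zero (μ := Measure.infinitePi (fun _ : ℕ => B.μ)) ?_)
    exact (bot_le.trans_lt hB).ne'
  have bd : ∀ C : Set (DIdx m → ℝ), ∃ c : ℝ, ∀ v, |bump C δ v| ≤ c := fun C =>
    ⟨1, fun v => by rw [abs_of_nonneg (bump_nonneg _ _ _)]; exact bump_le C δ hδ v⟩
  have tA := (hZ.2 m hm (bump CA δ) (bump_cont _ _) (bd CA)).eventually_const_lt
    (int_ge A.μ KA hKA hA m δ hδ)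
  have tB := (hW.2 m hm (bump CB δ) (bump_cont _ _) (bd CB)).eventually_const_lt
    (int_ge B.μ KB hKB hB m δ hδ)
  obtain ⟨n, hnA, hnB⟩ := (tA.and tB).exists
  obtain ⟨τ, hτm, -, hτmap, hτlip⟩ := hle n
  haveI := hWp n
  set Q := Measure.pi fun _ : Fin m => (W n).μ with hQ
  have hpi : Measurable (fun (y : Fin m → (W n).carrier) (i : Fin m) => τ (y i)) :=
    measurable_pi_lambda _ fun i => hτm.comp (measurable_pi_apply i)
  have hcA : Continuous (fun x : Fin m → (Z n).carrier => bump CA δ (distMatMap m x)) := (bump_cont CA δ).comp (distMatMap_cont (X := (Z n).carrier) m)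
  have hcB : Continuous (fun x : Fin m → (W n).carrier => bump CB δ (distMatMap m x)) := (bump_cont CB δ).comp (distMatMap_cont (X := (W n).carrier) m)
  have hQmap : Q.map (fun (y : Fin m → (W n).carrier) (i : Fin m) => τ (y i)) =
      Measure.pi fun _ : Fin m => (Z n).μ := by
    have : ∀ i : Fin m, SigmaFinite ((W n).μ.map τ) := fun i => by rw [hτmap]; infer_instance
    rw [hQ, Measure.pi_map_pi (fun _ => hτm.aemeasurable)]
    simp only [hτmap]
  rw [integral_nuM _ _ _ (bump_cont _ _), ← hQmap,
    integral_map hpi.aemeasurable hcA.aestronglyMeasurable] at hnA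
  rw [integral_nuM _ _ _ (bump_cont _ _)] at hnB
  have iA : Integrable (fun y => bump CA δ (distMatMap m (fun i => τ (y i)))) Q := by
    refine Integrable.of_bound (C := 1) (hcA.measurable.comp hpi).aestronglyMeasurable ?_
    refine Eventually.of_forall fun y => ?_
    rw [Real.norm_of_nonneg (bump_nonneg _ _ _)]
    exact bump_le CA δ hδ _
  have iB : Integrable (fun y => bump CB δ (distMatMap m y)) Q := by
    refine Integrable.of_bound (C := 1) hcB.measurable.aestronglyMeasurable ?_
    refine Eventually.of_forall fun y => ?_
    rw [Real.norm_of_nonneg (bump_nonneg _ _ _)]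
    exact bump_le CB δ hδ _
  have hsupp : ∀ᵐ y ∂Q, ∀ i, y i ∈ msupp (W n).μ := by
    rw [ae_all_iff]
    intro i
    exact (Measure.quasiMeasurePreserving_eval (fun _ : Fin m => (W n).μ) i).ae
      (ae_msupp (W n).μ)
  have hex : ∃ y : Fin m → (W n).carrier, (∀ i, y i ∈ msupp (W n).μ) ∧
      1 < bump CA δ (distMatMap m (fun i => τ (y i))) + bump CB δ (distMatMap m y) := by
    by_contra hc
    push Not at hc
    have : ∫ y, (bump CA δ (distMatMap m (fun i => τ (y i))) + bump CB δ (distMatMap m y)) ∂Q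
        ≤ ∫ y, (1 : ℝ) ∂Q := by
      refine integral_mono_ae (iA.add iB) (integrable_const _) ?_
      filter_upwards [hsupp] with y hy using hc y hy
    rw [integral_add iA iB] at this
    simp at this
    linarith
  obtain ⟨u, hu, hlt⟩ := hex
  have leA := bump_le CA δ hδ (distMatMap m (fun i => τ (u i)))
  have leB := bump_le CB δ hδ (distMatMap m u)
  obtain ⟨_, ⟨x, hx, rfl⟩, dx⟩ := bump_pos CA neA δ hδ _
    (show 0 < bump CA δ (distMatMap m (fun i => τ (u i))) by linarith)
  obtain ⟨_, ⟨y, hy, rfl⟩, dy⟩ := bump_pos CB neB δ hδ _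
    (show 0 < bump CB δ (distMatMap m u) by linarith)
  refine ⟨y, hy, x, hx, fun i j hij hj => ?_⟩
  let p : DIdx m := ⟨(⟨i, hij.trans hj⟩, ⟨j, hj⟩), hij⟩
  have d1 := (dist_le_pi_dist _ _ p).trans_lt dx
  have d2 := (dist_le_pi_dist _ _ p).trans_lt dy
  have d3 := hτlip _ (hu ⟨i, hij.trans hj⟩) _ (hu ⟨j, hj⟩)
  simp only [distMatMap, p, Real.dist_eq] at d1 d2
  have e1 := (abs_lt.1 d1).1
  have e2 := (abs_lt.1 d2).2
  linarith

/-- `≼_metric` is closed under Gromov-weak convergence of probability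
mm spaces. -/
theorem stmt4 (Z W : ℕ → MM) (A B : MM)
    (hZp : ∀ n, IsProbabilityMeasure (Z n).μ) (hWp : ∀ n, IsProbabilityMeasure (W n).μ)
    (hAp : IsProbabilityMeasure A.μ) (hBp : IsProbabilityMeasure B.μ)
    (hZ : GromovWeakTendsto Z A) (hW : GromovWeakTendsto W B)
    (hle : ∀ n, LeMetric (Z n).μ (W n).μ) :
    LeMetric A.μ B.μ := by
  let a : ProbabilityMeasure A.carrier := ⟨A.μ, hAp⟩
  let b : ProbabilityMeasure B.carrier := ⟨B.μ, hBp⟩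
  obtain ⟨KA, hKA, gA, hA⟩ := exists_compact_eqd a
  obtain ⟨KB, hKB, gB, hB⟩ := exists_compact_eqd b
  choose y hy x hx hyx using fun k : ℕ => fin_step Z W A B hWp hAp hBp hZ hW hle KA KB hKA hKB
    hA hB (k + 2) (by omega) (1 / ((k : ℝ) + 1)) (by positivity)
  obtain ⟨⟨y', x'⟩, ⟨hy', hx'⟩, φ, hφ, hlim⟩ := (hKB.prod hKA).tendsto_subseq
    (x := fun k => (y k, x k)) (fun k => ⟨hy k, hx k⟩)
  have ly : ∀ i, Tendsto (fun k => y (φ k) i) atTop (𝓝 (y' i)) := fun i =>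
    ((continuous_apply i).comp continuous_fst).continuousAt.tendsto.comp hlim
  have lx : ∀ i, Tendsto (fun k => x (φ k) i) atTop (𝓝 (x' i)) := fun i =>
    ((continuous_apply i).comp continuous_snd).continuousAt.tendsto.comp hlim
  have key : ∀ i j, i < j → dist (x' i) (x' j) ≤ dist (y' i) (y' j) := by
    intro i j hij
    have l0 : Tendsto (fun k => 2 * (1 / (((φ k : ℕ) : ℝ) + 1))) atTop (𝓝 0) := by
      simpa using (tendsto_one_div_add_atTop_nhds_zero_nat.comp hφ.tendsto_atTop).const_mul (2 : ℝ)
    have l1 := ((ly i).dist (ly j)).add l0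
    rw [add_zero] at l1
    refine le_of_tendsto_of_tendsto ((lx i).dist (lx j)) l1 ?_
    filter_upwards [eventually_ge_atTop j] with k hk
    have := hφ.id_le k
    simp only [id] at this
    exact hyx (φ k) i j hij (by omega)
  refine leMetric_of_eqd a b x' y' (gA _ hx') (gB _ hy') fun i j => ?_
  rcases lt_trichotomy i j with h | h | h
  · exact key i j h
  · simp [h]
  · rw [dist_comm, dist_comm (y' i)]
    exact key j i h

end MMOrder
end

section
/- The relation ≼ on mm spaces is transitive: if (X, r_X, μ_X), (Y, r_Y, μ_Y), (Z, r_Z, μ_Z) are mm spaces with (X, r_X, μ_X) ≼ (Y, r_Y, μ_Y) and (Y, r_Y, μ_Y) ≼ (Z, r_Z, μ_Z), then (X, r_X, μ_X) ≼ (Z, r_Z, μ_Z). -/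
open MeasureTheory Metric Filter Topology

namespace MMOrder

theorem msupp_compl_null {X : Type*} [MeasurableSpace X] [MetricSpace X]
    [SecondCountableTopology X] (μ : Measure X) : μ (msupp μ)ᶜ = 0 := by
  refine measure_null_of_locally_null _ fun x hx => ?_
  simp only [msupp, Set.mem_compl_iff, Set.mem_ofPred_eq, not_forall, not_lt, nonpos_iff_eq_zero] at hx
  obtain ⟨ε, hε, h⟩ := hx
  exact ⟨_, mem_nhdsWithin_of_mem_nhds (Metric.ball_mem_nhds x hε), h⟩

theorem msupp_mono {X : Type*} [MeasurableSpace X] [MetricSpace X]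
    {μ ν : Measure X} (h : μ ≤ ν) : msupp μ ⊆ msupp ν :=
  fun _ hx ε hε => (hx ε hε).trans_le (h _)

/-- the relation `≼` on mm spaces is transitive. -/
theorem stmt5 {X Y Z : Type*} [MeasurableSpace X] [MetricSpace X] [SecondCountableTopology X] [CompleteSpace X] [BorelSpace X] [MeasurableSpace Y] [MetricSpace Y] [SecondCountableTopology Y] [CompleteSpace Y] [BorelSpace Y] [MeasurableSpace Z] [MetricSpace Z] [SecondCountableTopology Z] [CompleteSpace Z] [BorelSpace Z]
    (μX : Measure X) (μY : Measure Y) (μZ : Measure Z)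
    [IsFiniteMeasure μX] [IsFiniteMeasure μY] [IsFiniteMeasure μZ]
    (h1 : LeGen μX μY) (h2 : LeGen μY μZ) :
    LeGen μX μZ := by
  obtain ⟨μY', hY, τ₁, m₁, s₁, p₁, l₁⟩ := h1
  obtain ⟨μZ', hZ, τ₂, m₂, s₂, p₂, l₂⟩ := h2
  have : IsFiniteMeasure μY' := isFiniteMeasure_of_le μY hY
  have : IsFiniteMeasure μZ' := isFiniteMeasure_of_le μZ hZ
  set f := μY'.rnDeriv μY with hf
  have mf : Measurable f := Measure.measurable_rnDeriv _ _
  have hf1 : f ≤ᵐ[μY] 1 := Measure.rnDeriv_le_one_of_le hY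
  have hfd : μY.withDensity f = μY' :=
    Measure.withDensity_rnDeriv_eq _ _ (Measure.absolutelyContinuous_of_le hY)
  set ν := μZ'.withDensity (f ∘ τ₂) with hν
  have hle : ν ≤ μZ' := by
    have h : f ∘ τ₂ ≤ᵐ[μZ'] 1 := by
      rw [← p₂] at hf1
      exact ae_of_ae_map m₂.aemeasurable hf1
    calc ν ≤ μZ'.withDensity 1 := withDensity_mono h
      _ = μZ' := withDensity_one
  have hmap : ν.map τ₂ = μY' := by
    ext s hs
    rw [Measure.map_apply m₂ hs, hν, withDensity_apply _ (m₂ hs), ← hfd, withDensity_apply _ hs,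
      ← p₂, setLIntegral_map hs mf m₂]
    rfl
  have hsub : msupp ν ⊆ msupp μZ' := msupp_mono hle
  have hmaps : Set.MapsTo τ₂ (msupp ν) (msupp μY') := by
    intro z hz ε hε
    rw [← hmap, Measure.map_apply m₂ measurableSet_ball]
    have h0 := hz ε hε
    refine h0.trans_le ?_
    have hae : ∀ᵐ w ∂ν, w ∈ msupp ν := mem_ae_iff.2 (msupp_compl_null ν)
    refine measure_mono_ae ?_
    filter_upwards [hae] with w hw hb
    exact (l₂ w (hsub hw) z (hsub hz)).trans_lt hb
  refine ⟨ν, hle.trans hZ, τ₁ ∘ τ₂, m₁.comp m₂, s₁.comp hmaps, ?_, fun a ha b hb => ?_⟩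
  · rw [← Measure.map_map m₁ m₂, hmap, p₁]
  · exact (l₁ _ (hmaps ha) _ (hmaps hb)).trans (l₂ _ (hsub ha) _ (hsub hb))

end MMOrder
end

section
/- Let (Y, r_Y, μ_Y) and (X', r', μ'_X) be mm spaces, let μ_X be a Borel measure on X' with μ_X ≤ μ'_X, and let τ : supp μ_Y → supp μ'_X be a measure-preserving sub-isometry from (Y, r_Y, μ_Y) to (X', r', μ'_X). Then there exists a Borel measure μ'_Y on Y with μ'_Y ≤ μ_Y such that the pushforward of μ'_Y under τ equals μ_X. -/
open MeasureTheory Metric Filter Topology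

namespace MMOrder

/-- if `μX ≤ μX'` and `τ` is a measure-preserving sub-isometry from
`(Y, r_Y, μY)` to `(X', r', μX')`, then some Borel measure `μY' ≤ μY` pushes forward
under `τ` to `μX`. -/
theorem stmt9 {X Y : Type*} [MeasurableSpace X] [MetricSpace X] [SecondCountableTopology X] [CompleteSpace X] [BorelSpace X] [MeasurableSpace Y] [MetricSpace Y] [SecondCountableTopology Y] [CompleteSpace Y] [BorelSpace Y]
    (μX' μX : Measure X) (μY : Measure Y)
    [IsFiniteMeasure μX'] [IsFiniteMeasure μX] [IsFiniteMeasure μY]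
    (hle : μX ≤ μX') (τ : Y → X) (hτ : IsMPSubIsom μX' μY τ) :
    ∃ μY' : Measure Y, μY' ≤ μY ∧ μY'.map τ = μX := by
  obtain ⟨hm, -, hmap, -⟩ := hτ
  have hac : μX ≪ μX' := Measure.absolutelyContinuous_of_le hle
  have hf : Measurable (μX.rnDeriv μX') := Measure.measurable_rnDeriv _ _
  have h1 : μX.rnDeriv μX' ≤ᵐ[μX'] 1 := Measure.rnDeriv_le_one_of_le hle
  have h2 : ∀ᵐ y ∂μY, μX.rnDeriv μX' (τ y) ≤ 1 := by
    have h3 : ∀ᵐ x ∂(μY.map τ), μX.rnDeriv μX' x ≤ 1 := by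
      rw [hmap]; exact h1
    exact ae_of_ae_map hm.aemeasurable h3
  refine ⟨μY.withDensity (fun y => μX.rnDeriv μX' (τ y)), ?_, ?_⟩
  · calc μY.withDensity (fun y => μX.rnDeriv μX' (τ y)) ≤ μY.withDensity 1 :=
          withDensity_mono h2
      _ = μY := withDensity_one
  · ext s hs
    rw [Measure.map_apply hm hs, withDensity_apply _ (hm hs),
      ← setLIntegral_map hs hf hm, hmap, ← withDensity_apply _ hs,
      Measure.withDensity_rnDeriv_eq _ _ hac]

end MMOrder
end

section
/- Let λ > 0 and let (X, r_X, μ_X), (Y, r_Y, μ_Y) be probability mm spaces with (X, r_X, μ_X) ≼_metric (Y, r_Y, μ_Y). Then dEur^λ((X,r_X,μ_X),(Y,r_Y,μ_Y)) = ∫ (1 − e^{−λ r}) ν^{2,(Y,r_Y,μ_Y)}(dr) − ∫ (1 − e^{−λ r}) ν^{2,(X,r_X,μ_X)}(dr). -/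
open MeasureTheory Metric Filter Topology

namespace MMOrder

theorem ae_msupp_s10 {Y : Type*} [MeasurableSpace Y] [MetricSpace Y] [SecondCountableTopology Y]
    (μ : Measure Y) : ∀ᵐ y ∂μ, y ∈ msupp μ := by
  rw [ae_iff]
  refine measure_null_of_locally_null _ fun y hy => ?_
  simp only [msupp, Set.mem_setOf_eq, not_forall, not_lt, nonpos_iff_eq_zero] at hy
  obtain ⟨ε, hε, h0⟩ := hy
  exact ⟨Metric.ball y ε, mem_nhdsWithin_of_mem_nhds (Metric.ball_mem_nhds y hε), h0⟩

theorem nu2Int_eq {X Z : Type*} [MeasurableSpace X] [MetricSpace X] [SecondCountableTopology X]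
    [BorelSpace X] [MeasurableSpace Z] (l : ℝ) (μ : Measure X) (Q : Measure Z)
    [IsProbabilityMeasure μ] [IsProbabilityMeasure Q]
    (f : Z → X) (hf : Measurable f) (hQ : Q.map f = μ) :
    nu2Int l μ = ∫ p, (1 - Real.exp (-l * dist (f p.1) (f p.2))) ∂(Q.prod Q) := by
  have hmp : MeasurePreserving f Q μ := ⟨hf, hQ⟩
  have hd : Measurable (fun p : X × X => dist p.1 p.2) := continuous_dist.measurable
  have hg : Measurable (fun r : ℝ => 1 - Real.exp (-l * r)) := by fun_prop
  have h2 := hmp.prod hmp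
  unfold nu2Int nu2
  rw [integral_map hd.aemeasurable hg.aestronglyMeasurable, ← h2.map_eq]
  exact integral_map h2.measurable.aemeasurable (hg.comp hd).aestronglyMeasurable

theorem integrable_aux {X Z : Type*} [MeasurableSpace X] [MetricSpace X]
    [SecondCountableTopology X] [BorelSpace X] [MeasurableSpace Z] (l : ℝ) (hl : 0 < l)
    (Q : Measure Z) [IsProbabilityMeasure Q] (f : Z → X) (hf : Measurable f) :
    Integrable (fun p : Z × Z => 1 - Real.exp (-l * dist (f p.1) (f p.2))) (Q.prod Q) := by
  refine Integrable.of_bound (C := 1) ?_ (Eventually.of_forall fun p => ?_)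
  · exact (by fun_prop : Measurable _).aestronglyMeasurable
  · have h1 : Real.exp (-l * dist (f p.1) (f p.2)) ≤ 1 := by
      rw [Real.exp_le_one_iff]
      have := mul_nonneg hl.le (dist_nonneg (x := f p.1) (y := f p.2))
      linarith
    have h0 := Real.exp_pos (-l * dist (f p.1) (f p.2))
    rw [Real.norm_eq_abs, abs_le]
    constructor <;> linarith

theorem diff_eq {X Y : Type*} [MeasurableSpace X] [MetricSpace X] [SecondCountableTopology X]
    [BorelSpace X] [MeasurableSpace Y] [MetricSpace Y] [SecondCountableTopology Y] [BorelSpace Y]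
    (l : ℝ) (hl : 0 < l) (μX : Measure X) (μY : Measure Y)
    [IsProbabilityMeasure μX] [IsProbabilityMeasure μY] (Q : Measure (X × Y))
    [IsProbabilityMeasure Q] (hQ : IsCoupling μX μY Q) :
    nu2Int l μY - nu2Int l μX = ∫ p, (Real.exp (-l * dist p.1.1 p.2.1) -
      Real.exp (-l * dist p.1.2 p.2.2)) ∂(Q.prod Q) := by
  rw [nu2Int_eq l μY Q Prod.snd measurable_snd hQ.2, nu2Int_eq l μX Q Prod.fst measurable_fst hQ.1,
    ← integral_sub (integrable_aux l hl Q _ measurable_snd)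
      (integrable_aux l hl Q _ measurable_fst)]
  congr 1
  ext p
  ring

/-- if `(X, r_X, μ_X) ≼_metric (Y, r_Y, μ_Y)` (probability mm spaces), then
`dEur^λ` equals the difference of the integrals of `1 - e^{-λ r}` against the distance
matrix measures of order 2. -/
theorem stmt10 {X Y : Type*} [MeasurableSpace X] [MetricSpace X] [SecondCountableTopology X] [CompleteSpace X] [BorelSpace X] [MeasurableSpace Y] [MetricSpace Y] [SecondCountableTopology Y] [CompleteSpace Y] [BorelSpace Y]
    (l : ℝ) (hl : 0 < l)
    (μX : Measure X) (μY : Measure Y)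
    [IsProbabilityMeasure μX] [IsProbabilityMeasure μY]
    (h : LeMetric μX μY) :
    dEur l μX μY = nu2Int l μY - nu2Int l μX := by
  obtain ⟨τ, hτ, -, hmap, hlip⟩ := h
  have hm : Measurable (fun y => (τ y, y)) := hτ.prodMk measurable_id
  have hcQ : IsCoupling μX μY (μY.map fun y => (τ y, y)) := by
    constructor
    · rw [Measure.map_map measurable_fst hm]; exact hmap
    · rw [Measure.map_map measurable_snd hm]; exact Measure.map_id
  refine IsLeast.csInf_eq ⟨⟨_, hcQ, ?_⟩, ?_⟩
  · have : IsProbabilityMeasure (μY.map fun y => (τ y, y)) :=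
      Measure.isProbabilityMeasure_map hm.aemeasurable
    rw [diff_eq l hl μX μY _ hcQ]
    unfold eurCost
    apply integral_congr_ae
    have hae := ae_msupp_s10 μY
    have hsnd : ∀ᵐ p : (Y × Y) ∂(μY.prod μY), p.1 ∈ msupp μY ∧ p.2 ∈ msupp μY :=
      (Measure.quasiMeasurePreserving_fst.ae hae).and (Measure.quasiMeasurePreserving_snd.ae hae)
    rw [Measure.map_prod_map _ _ hm hm]
    have hms : MeasurableSet {p : (X × Y) × (X × Y) |
        Real.exp (-l * dist p.1.1 p.2.1) - Real.exp (-l * dist p.1.2 p.2.2) =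
        |Real.exp (-l * dist p.1.2 p.2.2) - Real.exp (-l * dist p.1.1 p.2.1)|} :=
      measurableSet_eq_fun (by fun_prop) (by fun_prop)
    refine (ae_map_iff (hm.prodMap hm).aemeasurable hms).2 ?_
    filter_upwards [hsnd] with p hp
    have h1 := hlip _ hp.1 _ hp.2
    have h2 : Real.exp (-l * dist p.1 p.2) ≤ Real.exp (-l * dist (τ p.1) (τ p.2)) := by
      apply Real.exp_le_exp.2
      nlinarith
    simp only [Prod.map]
    rw [abs_of_nonpos (by linarith)]
    ring
  · rintro c ⟨Q, hQ, rfl⟩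
    have : IsProbabilityMeasure Q := by
      constructor
      have h1 : Q.map Prod.fst Set.univ = 1 := by rw [hQ.1]; exact measure_univ
      rwa [Measure.map_apply measurable_fst MeasurableSet.univ, Set.preimage_univ] at h1
    rw [diff_eq l hl μX μY Q hQ]
    unfold eurCost
    refine (le_abs_self _).trans (abs_integral_le_integral_abs.trans_eq ?_)
    simp only [abs_sub_comm]

end MMOrder
end
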